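/- arXiv:1610.07891 — 2 statements merged into one kernel-verified Lean document; each statement's English description precedes it below -/
import Mathlib

section
/- Assume Q = q is a power of p and that p divides N_j for every j ∉ J. For 1 ≤ i ≤ m set r(N_i) = ⌊(N_i − 1)/2⌋ if N_i is even and r(N_i) = (N_i − 1)/2 − 1 if N_i is odd, and let R_i(J) = { b : ε_j ≤ b_j ≤ N_j − 1 for all j, and b_i ≤ r(N_i) }. Let t ≤ n_J be a positive integer and suppose there exists an index i with N(J,t) ⊆ R_i(J). Then F(J,t) ⊆ F(J,t)^⊥ (Euclidean duality), dim_{F_q} F(J,t) = card(N(J,t)), and every nonzero codeword of F(J,t)^⊥ has Hamming weight at least t. -/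
/-- `ε_j = 1` if `j ∈ J` and `0` otherwise. -/
def eps {m : ℕ} (J : Finset (Fin m)) (j : Fin m) : ℕ := if j ∈ J then 1 else 0

/-- The points `Z_J` of the `J`-affine variety. -/
def ZJ (F : Type) [Field F] [Fintype F] [DecidableEq F] {m : ℕ} (N : Fin m → ℕ)
    (J : Finset (Fin m)) : Finset (Fin m → F) :=
  Finset.univ.filter
    (fun x => ∀ j, (j ∈ J → x j ^ (N j - 1) = 1) ∧ (j ∉ J → x j ^ (N j) = x j))

/-- Evaluation of the monomial `X^b` at all the points of `Z_J`. -/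
def evm (F : Type) [Field F] [Fintype F] [DecidableEq F] {m : ℕ} (N : Fin m → ℕ)
    (J : Finset (Fin m)) (b : Fin m → ℕ) : ↥(ZJ F N J) → F :=
  fun P => ∏ j, P.1 j ^ b j

/-- The set `N(J,t)` of exponent tuples. -/
def NSet {m : ℕ} (N : Fin m → ℕ) (J : Finset (Fin m)) (t : ℕ) : Set (Fin m → ℕ) :=
  { b | (∀ j, eps J j ≤ b j ∧ b j ≤ N j - 1) ∧ ∏ j, (b j + 1 - eps J j) < t }

/-- The code `F(J,t)`: the span of the evaluations of the monomials with exponents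
in `N(J,t)`. -/
noncomputable def Fcode (F : Type) [Field F] [Fintype F] [DecidableEq F] {m : ℕ}
    (N : Fin m → ℕ) (J : Finset (Fin m)) (t : ℕ) : Submodule F (↥(ZJ F N J) → F) :=
  Submodule.span F { v | ∃ b ∈ NSet N J t, v = evm F N J b }

/-- `r(N_i) = ⌊(N_i − 1)/2⌋` if `N_i` is even and `(N_i − 1)/2 − 1` if `N_i` is odd. -/
def rN (n : ℕ) : ℕ := if Even n then (n - 1) / 2 else (n - 1) / 2 - 1

/-- The set `R_i(J)` of exponent tuples. -/
def RiSet {m : ℕ} (N : Fin m → ℕ) (J : Finset (Fin m)) (i : Fin m) : Set (Fin m → ℕ) :=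
  { b | (∀ j, eps J j ≤ b j ∧ b j ≤ N j - 1) ∧ b i ≤ rN (N i) }

/-- A nonzero function on a field with finite support of size `s` has a nonzero power moment of
order less than `s`. -/
theorem exists_lt_card_support_sum_mul_pow_ne_zero {F : Type*} [Field F] [Fintype F]
    [DecidableEq F] (g : F → F) {a₀ : F} (ha₀ : g a₀ ≠ 0) :
    ∃ k < (Finset.univ.filter (fun a => g a ≠ 0)).card, ∑ a, g a * a ^ k ≠ 0 := by
  classical
  by_contra! h
  set A := Finset.univ.filter (fun a => g a ≠ 0) with hA
  have haA : a₀ ∈ A := by simp [hA, ha₀]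
  let P : Polynomial F := ∏ a ∈ A.erase a₀, (Polynomial.X - Polynomial.C a)
  have hdeg : P.natDegree < A.card := by
    rw [Polynomial.natDegree_prod_of_monic _ _ (fun a _ => Polynomial.monic_X_sub_C a)]
    simp only [Polynomial.natDegree_X_sub_C, Finset.sum_const, smul_eq_mul, mul_one]
    exact Finset.card_erase_lt_of_mem haA
  have hzero : ∑ a, g a * P.eval a = 0 := by
    simp_rw [Polynomial.eval_eq_sum_range' hdeg, Finset.mul_sum]
    rw [Finset.sum_comm]
    refine Finset.sum_eq_zero fun k hk => ?_
    have := h k (Finset.mem_range.1 hk)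
    calc ∑ a, g a * (P.coeff k * a ^ k) = P.coeff k * ∑ a, g a * a ^ k := by
          rw [Finset.mul_sum]; exact Finset.sum_congr rfl fun a _ => by ring
      _ = 0 := by rw [this, mul_zero]
  rw [Finset.sum_eq_single a₀] at hzero
  · refine (mul_ne_zero ha₀ ?_) hzero
    simp only [P, Polynomial.eval_prod, Polynomial.eval_sub, Polynomial.eval_X,
      Polynomial.eval_C]
    refine Finset.prod_ne_zero_iff.2 fun a ha => sub_ne_zero.2 ?_
    exact (Finset.ne_of_mem_erase ha).symm
  · intro a _ ha
    by_cases hga : g a = 0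
    · simp [hga]
    · have haP : P.eval a = 0 := by
        simp only [P, Polynomial.eval_prod]
        exact Finset.prod_eq_zero (i := a) (by simp [hA, ha, hga]) (by simp)
      simp [haP]
  · simp

theorem Fintype.sum_fin_succ_arrow {F M : Type*} [Fintype F] [AddCommMonoid M] {m : ℕ}
    (f : (Fin (m + 1) → F) → M) :
    ∑ x, f x = ∑ a : F, ∑ x : Fin m → F, f (Fin.cons a x) := by
  rw [← (Fin.consEquiv (fun _ : Fin (m + 1) => F)).sum_comp, Fintype.sum_prod_type]
  rfl

/-- A nonzero function supported in a grid pairs nontrivially with a monomial of the associated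
box whose hyperbolic degree is at most the size of the support. -/
theorem exists_monomial_sum_ne_zero {F : Type*} [Field F] [Fintype F] [DecidableEq F] {m : ℕ}
    (S : Fin m → Finset F) (y : (Fin m → F) → F) (hS : ∀ x, y x ≠ 0 → ∀ j, x j ∈ S j)
    (hy : y ≠ 0) :
    ∃ b : Fin m → ℕ, (∀ j, b j < (S j).card) ∧
      ∏ j, (b j + 1) ≤ (Finset.univ.filter (fun x => y x ≠ 0)).card ∧
      ∑ x, y x * ∏ j, x j ^ b j ≠ 0 := by
  classical
  induction m with
  | zero =>
    obtain ⟨x, hx⟩ := Function.ne_iff.1 hy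
    refine ⟨0, fun j => j.elim0, ?_, ?_⟩
    · rw [Finset.univ_eq_empty, Finset.prod_empty]
      exact Finset.card_pos.2 ⟨x, Finset.mem_filter.2 ⟨Finset.mem_univ _, hx⟩⟩
    · rw [Fintype.sum_subsingleton _ x]
      simpa using hx
  | succ m ih =>
    let w : F → ℕ := fun a => (Finset.univ.filter (fun x : Fin m → F => y (Fin.cons a x) ≠ 0)).card
    let B : Finset F := Finset.univ.filter (fun a => w a ≠ 0)
    have hcard : (Finset.univ.filter (fun x => y x ≠ 0)).card = ∑ a, w a := by
      simp only [w, Finset.card_filter]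
      exact Fintype.sum_fin_succ_arrow _
    have hB : B.Nonempty := by
      obtain ⟨x, hx⟩ := Function.ne_iff.1 hy
      refine ⟨x 0, ?_⟩
      simp only [B, Finset.mem_filter, Finset.mem_univ, true_and, w]
      refine (Finset.card_pos.2 ⟨Fin.tail x, ?_⟩).ne'
      simpa using hx
    obtain ⟨a₀, ha₀, hmin⟩ := B.exists_min_image w hB
    obtain ⟨b, hb, hbw, hbs⟩ := ih (fun j => S j.succ) (fun x => y (Fin.cons a₀ x))
      (fun x hx j => by simpa using hS _ hx j.succ)
      (by
        intro h
        simp only [B, w, Finset.mem_filter] at ha₀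
        refine ha₀.2 ?_
        simp [fun x => congrFun h x])
    let g : F → F := fun a => ∑ x : Fin m → F, y (Fin.cons a x) * ∏ j, x j ^ b j
    obtain ⟨k, hk, hks⟩ := exists_lt_card_support_sum_mul_pow_ne_zero g (a₀ := a₀) hbs
    have hgB : Finset.univ.filter (fun a => g a ≠ 0) ⊆ B := by
      intro a ha
      simp only [Finset.mem_filter, Finset.mem_univ, true_and, g] at ha
      obtain ⟨x, -, hx⟩ := Finset.exists_ne_zero_of_sum_ne_zero ha
      simp only [B, w, Finset.mem_filter, Finset.mem_univ, true_and]
      exact (Finset.card_pos.2 ⟨x, by simpa using left_ne_zero_of_mul hx⟩).ne'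
    have hBS : B ⊆ S 0 := by
      intro a ha
      simp only [B, w, Finset.mem_filter, Finset.mem_univ, true_and] at ha
      obtain ⟨x, hx⟩ := Finset.card_pos.1 (Nat.pos_of_ne_zero ha)
      simpa using hS _ (Finset.mem_filter.1 hx).2 0
    have hkB : k + 1 ≤ B.card := hk.trans_le (Finset.card_le_card hgB)
    refine ⟨Fin.cons k b, ?_, ?_, ?_⟩
    · intro j
      refine Fin.cases ?_ (fun j => ?_) j
      · simpa using hkB.trans (Finset.card_le_card hBS)
      · simpa using hb j
    · rw [Fin.prod_univ_succ, hcard]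
      simp only [Fin.cons_zero, Fin.cons_succ]
      calc (k + 1) * ∏ j, (b j + 1) ≤ B.card * w a₀ := Nat.mul_le_mul hkB hbw
        _ = ∑ a ∈ B, w a₀ := by simp
        _ ≤ ∑ a ∈ B, w a := Finset.sum_le_sum hmin
        _ ≤ ∑ a, w a := Finset.sum_le_univ_sum_of_nonneg (fun _ => Nat.zero_le _)
    · rw [Fintype.sum_fin_succ_arrow]
      convert hks using 2 with a
      rw [Finset.sum_mul]
      refine Finset.sum_congr rfl fun x _ => ?_
      rw [Fin.prod_univ_succ]
      simp only [Fin.cons_zero, Fin.cons_succ]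
      ring

/-- The set of values of the `j`-th coordinate of the points of `Z_J`. -/
def coordSet (F : Type) [Field F] [Fintype F] [DecidableEq F] {m : ℕ} (N : Fin m → ℕ)
    (J : Finset (Fin m)) (j : Fin m) : Finset F :=
  Finset.univ.filter (fun x => (j ∈ J → x ^ (N j - 1) = 1) ∧ (j ∉ J → x ^ (N j) = x))

theorem ZJ_eq_piFinset (F : Type) [Field F] [Fintype F] [DecidableEq F] {m : ℕ}
    (N : Fin m → ℕ) (J : Finset (Fin m)) :
    ZJ F N J = Fintype.piFinset (coordSet F N J) := by
  ext x
  simp [ZJ, coordSet]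

theorem FiniteField.exists_isPrimitiveRoot {F : Type*} [Field F] [Fintype F] {n : ℕ}
    (hn : n ∣ Fintype.card F - 1) : ∃ ζ : F, IsPrimitiveRoot ζ n := by
  classical
  obtain ⟨g, hg⟩ := IsCyclic.exists_generator (α := Fˣ)
  have hg' : IsPrimitiveRoot g (Fintype.card F - 1) := by
    rw [← Fintype.card_units, ← Nat.card_eq_fintype_card, ← orderOf_eq_card_of_forall_mem_zpowers hg]
    exact IsPrimitiveRoot.orderOf g
  obtain ⟨d, hd⟩ := hn
  have hpos : 0 < Fintype.card F - 1 := by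
    have := Fintype.one_lt_card (α := F); omega
  exact ⟨_, (IsPrimitiveRoot.coe_units_iff.2 (hg'.pow hpos (hd.trans (mul_comm _ _))))⟩

theorem card_coordSet {F : Type} [Field F] [Fintype F] [DecidableEq F] {m : ℕ}
    {N : Fin m → ℕ} (J : Finset (Fin m)) {j : Fin m} (hN : 1 < N j)
    (hdvd : (N j - 1) ∣ (Fintype.card F - 1)) :
    (coordSet F N J j).card = N j - eps J j := by
  obtain ⟨ζ, hζ⟩ := FiniteField.exists_isPrimitiveRoot hdvd
  have hpos : 0 < N j - 1 := by omega
  have hroots : Polynomial.nthRootsFinset (N j - 1) (1 : F) =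
      Finset.univ.filter (fun x => x ^ (N j - 1) = 1) := by
    ext x
    simp [Polynomial.mem_nthRootsFinset hpos]
  have hcard := hζ.card_nthRootsFinset
  by_cases hj : j ∈ J
  · have : coordSet F N J j = Polynomial.nthRootsFinset (N j - 1) (1 : F) := by
      rw [hroots]; ext x; simp [coordSet, hj]
    rw [this, hcard]
    simp [eps, hj]
  · have : coordSet F N J j = insert 0 (Polynomial.nthRootsFinset (N j - 1) (1 : F)) := by
      rw [hroots]
      ext x
      obtain ⟨n, hn⟩ : ∃ n, N j = n + 1 := ⟨N j - 1, by omega⟩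
      simp only [coordSet, hj, hn, Finset.mem_filter, Finset.mem_univ, true_and,
        Finset.mem_insert, Nat.add_sub_cancel, false_imp_iff, not_false_eq_true, true_imp_iff]
      rw [pow_succ, mul_left_eq_self₀, or_comm]
    rw [this, Finset.card_insert_of_notMem, hcard]
    · simp only [eps, hj, if_false]; omega
    · rw [hroots]; simp [hpos.ne']

theorem sum_coordSet_pow_eq_zero {F : Type} [Field F] [Fintype F] [DecidableEq F] {m : ℕ}
    {N : Fin m → ℕ} (J : Finset (Fin m)) {j : Fin m} (hN : 1 < N j)
    (hdvd : (N j - 1) ∣ (Fintype.card F - 1)) {k : ℕ} (hk : k ≠ 0) (hkN : k < N j - 1) :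
    ∑ x ∈ coordSet F N J j, x ^ k = 0 := by
  obtain ⟨ζ, hζ⟩ := FiniteField.exists_isPrimitiveRoot hdvd
  have hpos : 0 < N j - 1 := by omega
  have hζ0 : ζ ≠ 0 := hζ.ne_zero hpos.ne'
  have hζN : ζ ^ N j = ζ := by
    conv_lhs => rw [show N j = N j - 1 + 1 by omega, pow_succ, hζ.pow_eq_one, one_mul]
  have hsum : ∑ x ∈ coordSet F N J j, x ^ k = ∑ x ∈ coordSet F N J j, (ζ * x) ^ k := by
    symm
    refine Finset.sum_equiv (Equiv.mulLeft₀ ζ hζ0) (fun x => ?_) (fun x _ => rfl)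
    simp [coordSet, mul_pow, hζN, hζ.pow_eq_one, hζ0]
  simp_rw [mul_pow, ← Finset.mul_sum] at hsum
  by_contra h
  exact hζ.pow_ne_one_of_pos_of_lt hk hkN (mul_right_cancel₀ h (by rw [← hsum, one_mul]))

/-- Every nonzero word pairs nontrivially with the evaluation of a monomial whose shifted
hyperbolic degree is at most the weight of the word. -/
theorem exists_evm_sum_ne_zero {F : Type} [Field F] [Fintype F] [DecidableEq F] {m : ℕ}
    {N : Fin m → ℕ} (J : Finset (Fin m)) (hN : ∀ j, 1 < N j)
    (hdvd : ∀ j, (N j - 1) ∣ (Fintype.card F - 1)) (y : ↥(ZJ F N J) → F) (hy : y ≠ 0) :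
    ∃ c : Fin m → ℕ, (∀ j, c j < N j - eps J j) ∧
      ∏ j, (c j + 1) ≤ (Finset.univ.filter (fun i => y i ≠ 0)).card ∧
      ∑ i, evm F N J (fun j => c j + eps J j) i * y i ≠ 0 := by
  let z : (Fin m → F) → F := fun x =>
    if h : x ∈ ZJ F N J then y ⟨x, h⟩ * ∏ j, x j ^ eps J j else 0
  have hunit : ∀ x ∈ ZJ F N J, ∏ j, x j ^ eps J j ≠ 0 := by
    intro x hx
    refine Finset.prod_ne_zero_iff.2 fun j _ => ?_
    by_cases hj : j ∈ J
    · have h1 := ((Finset.mem_filter.1 hx).2 j).1 hj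
      have hNj := hN j
      simp only [eps, hj, if_true, pow_one]
      rintro h0
      rw [h0, zero_pow (by omega)] at h1
      exact zero_ne_one h1
    · simp [eps, hj]
  have hzmem : ∀ x, z x ≠ 0 → x ∈ ZJ F N J := by
    intro x hx
    by_contra h
    exact hx (by simp [z, h])
  have hzy : ∀ i : ↥(ZJ F N J), z i.1 = y i * ∏ j, i.1 j ^ eps J j := by
    intro i; simp [z]
  obtain ⟨c, hc, hcw, hcs⟩ := exists_monomial_sum_ne_zero (coordSet F N J) z
    (fun x hx j => by
      have := hzmem x hx
      rw [ZJ_eq_piFinset, Fintype.mem_piFinset] at this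
      exact this j)
    (by
      obtain ⟨i, hi⟩ := Function.ne_iff.1 hy
      exact Function.ne_iff.2 ⟨i.1, by rw [hzy]; exact mul_ne_zero hi (hunit _ i.2)⟩)
  refine ⟨c, fun j => (hc j).trans_eq (card_coordSet J (hN j) (hdvd j)), hcw.trans ?_, ?_⟩
  · refine Finset.card_le_card_of_surjOn Subtype.val ?_
    intro x hx
    have hx' : z x ≠ 0 := by simpa using hx
    refine ⟨⟨x, hzmem x hx'⟩, ?_, rfl⟩
    have h := hzy ⟨x, hzmem x hx'⟩
    rw [h] at hx'
    simpa using left_ne_zero_of_mul hx'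
  · convert hcs using 1
    rw [← Finset.sum_subset (f := fun x => z x * ∏ j, x j ^ c j)
      (Finset.subset_univ (ZJ F N J)), ← Finset.sum_coe_sort (ZJ F N J)]
    · refine Finset.sum_congr rfl fun i _ => ?_
      rw [hzy]
      simp only [evm, pow_add, Finset.prod_mul_distrib]
      ring
    · intro x _ hx
      simp [z, hx]

theorem linearIndependent_evm {F : Type} [Field F] [Fintype F] [DecidableEq F] {m : ℕ}
    {N : Fin m → ℕ} (J : Finset (Fin m)) (hN : ∀ j, 1 < N j)
    (hdvd : ∀ j, (N j - 1) ∣ (Fintype.card F - 1)) :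
    LinearIndependent F (fun c : (∀ j, Fin (N j - eps J j)) =>
      evm F N J (fun j => c j + eps J j)) := by
  refine linearIndependent_of_top_le_span_of_card_eq_finrank ?_ ?_
  · by_contra h
    obtain ⟨f, hf0, hf⟩ := Submodule.exists_le_ker_of_lt_top _ (lt_top_iff_ne_top.2 (fun h' => h (top_le_iff.2 h')))
    let y : ↥(ZJ F N J) → F := fun i => f (Pi.single i 1)
    have hfy : ∀ v, f v = ∑ i, v i * y i := by
      intro v
      conv_lhs => rw [pi_eq_sum_univ' v, map_sum]
      refine Finset.sum_congr rfl fun i _ => ?_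
      rw [map_smul, smul_eq_mul]
    obtain ⟨c, hc, -, hcs⟩ := exists_evm_sum_ne_zero J hN hdvd y (by
      rintro h0
      refine hf0 (LinearMap.ext fun v => ?_)
      simp [hfy, h0])
    refine hcs ?_
    rw [← hfy]
    exact hf (Submodule.subset_span ⟨fun j => ⟨c j, hc j⟩, rfl⟩)
  · simp only [Fintype.card_pi, Fintype.card_fin, Module.finrank_fintype_fun_eq_card,
      Fintype.card_coe, ZJ_eq_piFinset, Fintype.card_piFinset]
    exact Finset.prod_congr rfl fun j _ => (card_coordSet J (hN j) (hdvd j)).symm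

theorem sum_evm_mul_evm {F : Type} [Field F] [Fintype F] [DecidableEq F] {m : ℕ}
    (N : Fin m → ℕ) (J : Finset (Fin m)) (b c : Fin m → ℕ) :
    ∑ i, evm F N J b i * evm F N J c i = ∏ j, ∑ x ∈ coordSet F N J j, x ^ (b j + c j) := by
  rw [Finset.prod_univ_sum, ← ZJ_eq_piFinset, ← Finset.sum_coe_sort (ZJ F N J)]
  exact Finset.sum_congr rfl fun i _ => by simp only [evm, pow_add, Finset.prod_mul_distrib]

theorem finrank_Fcode {F : Type} [Field F] [Fintype F] [DecidableEq F] {m : ℕ}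
    {N : Fin m → ℕ} (J : Finset (Fin m)) (hN : ∀ j, 1 < N j)
    (hdvd : ∀ j, (N j - 1) ∣ (Fintype.card F - 1)) (t : ℕ) :
    Module.finrank F (Fcode F N J t) = Nat.card (NSet N J t) := by
  let φ : NSet N J t → ∀ j, Fin (N j - eps J j) := fun b j =>
    ⟨b.1 j - eps J j, by
      have h1 := b.2.1 j
      have h2 := hN j
      omega⟩
  have hφ : ∀ b j, (φ b j : ℕ) + eps J j = b.1 j := fun b j => Nat.sub_add_cancel (b.2.1 j).1
  have hinj : Function.Injective φ := by
    intro b c h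
    ext j
    rw [← hφ, ← hφ, h]
  have := Fintype.ofInjective φ hinj
  have hli : LinearIndependent F (fun b : NSet N J t => evm F N J b.1) := by
    have h := (linearIndependent_evm (F := F) J hN hdvd).comp φ hinj
    simpa only [Function.comp_def, hφ] using h
  have hspan : Fcode F N J t =
      Submodule.span F (Set.range fun b : NSet N J t => evm F N J b.1) := by
    unfold Fcode
    congr 1
    ext v
    simp [eq_comm]
  rw [hspan, finrank_span_eq_card hli, Nat.card_eq_fintype_card]

theorem sum_mul_eq_zero_of_mem_Fcode {F : Type} [Field F] [Fintype F] [DecidableEq F] {m : ℕ}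
    {N : Fin m → ℕ} {J : Finset (Fin m)} {t : ℕ} {y : ↥(ZJ F N J) → F}
    (h : ∀ b ∈ NSet N J t, ∑ i, evm F N J b i * y i = 0) {x : ↥(ZJ F N J) → F}
    (hx : x ∈ Fcode F N J t) : ∑ i, x i * y i = 0 := by
  induction hx using Submodule.span_induction with
  | mem x hx => obtain ⟨b, hb, rfl⟩ := hx; exact h b hb
  | zero => simp
  | add u v _ _ hu hv => simp only [Pi.add_apply, add_mul, Finset.sum_add_distrib, hu, hv, add_zero]
  | smul a u _ hu => simp only [Pi.smul_apply, smul_eq_mul, mul_assoc, ← Finset.mul_sum, hu, mul_zero]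

/-- Theorem 7 of the paper. If `p ∣ N_j` for all `j ∉ J` and
`N(J,t) ⊆ R_i(J)` for some `i`, then `F(J,t)` is Euclidean self-orthogonal, has
dimension `card N(J,t)`, and its dual has minimum distance at least `t`. -/
theorem Fcode_euclidean_self_orthogonal_of_NSet_subset
    (p e m : ℕ) (hp : p.Prime) (he : 0 < e)
    (F : Type) [Field F] [Fintype F] [DecidableEq F]
    (hF : Fintype.card F = p ^ e)
    (N : Fin m → ℕ) (hN : ∀ j, 1 < N j)
    (hNdvd : ∀ j, (N j - 1) ∣ (Fintype.card F - 1))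
    (J : Finset (Fin m)) (hpN : ∀ j ∉ J, p ∣ N j)
    (t : ℕ) (ht : 1 ≤ t) (htn : t ≤ ∏ j, (N j - eps J j))
    (hsub : ∃ i : Fin m, NSet N J t ⊆ RiSet N J i) :
    (∀ x ∈ Fcode F N J t, ∀ y ∈ Fcode F N J t, ∑ i, x i * y i = 0) ∧
    Module.finrank F (Fcode F N J t) = Nat.card (NSet N J t) ∧
    (∀ y : ↥(ZJ F N J) → F,
      (∀ x ∈ Fcode F N J t, ∑ i, x i * y i = 0) → y ≠ 0 →
      t ≤ (Finset.univ.filter (fun i => y i ≠ 0)).card) := by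
  refine ⟨?_, finrank_Fcode J hN hNdvd t, ?_⟩
  · obtain ⟨i, hi⟩ := hsub
    have hcast : ∀ j ∉ J, ((N j : ℕ) : F) = 0 := by
      intro j hj
      have hp0 : (p : F) = 0 := by
        have h := Nat.cast_card_eq_zero F
        rw [hF, Nat.cast_pow] at h
        exact eq_zero_of_pow_eq_zero h
      obtain ⟨d, hd⟩ := hpN j hj
      rw [hd, Nat.cast_mul, hp0, zero_mul]
    have hmono : ∀ b ∈ NSet N J t, ∀ c ∈ NSet N J t,
        ∑ P, evm F N J b P * evm F N J c P = 0 := by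
      intro b hb c hc
      rw [sum_evm_mul_evm]
      refine Finset.prod_eq_zero (Finset.mem_univ i) ?_
      have hbi := (hi hb).2
      have hci := (hi hc).2
      have hlt : b i + c i < N i - 1 := by
        have hNi := hN i
        unfold rN at hbi hci
        split_ifs at hbi hci with hpar
        · obtain ⟨d, hd⟩ := hpar
          omega
        · obtain ⟨d, hd⟩ := Nat.not_even_iff_odd.1 hpar
          omega
      by_cases h0 : b i + c i = 0
      · have hiJ : i ∉ J := by
          intro h
          have := (hb.1 i).1
          simp only [eps, h, if_true] at this
          omega
        have hcard := card_coordSet (F := F) J (hN i) (hNdvd i)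
        simp only [eps, hiJ, if_false, Nat.sub_zero] at hcard
        simp [h0, hcard, hcast i hiJ]
      · exact sum_coordSet_pow_eq_zero J (hN i) (hNdvd i) h0 hlt
    intro x hx y hy
    refine sum_mul_eq_zero_of_mem_Fcode (fun b hb => ?_) hx
    simp_rw [mul_comm (evm F N J b _)]
    exact sum_mul_eq_zero_of_mem_Fcode (fun c hc => hmono c hc b hb) hy
  · intro y hy hy0
    by_contra! hlt
    obtain ⟨c, hc, hcw, hcs⟩ := exists_evm_sum_ne_zero J hN hNdvd y hy0
    refine hcs (hy _ (Submodule.subset_span ⟨_, ⟨fun j => ?_, ?_⟩, rfl⟩))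
    · have := hc j
      omega
    · refine lt_of_eq_of_lt (Finset.prod_congr rfl fun j _ => ?_) (hcw.trans_lt hlt)
      omega
end

section
/- Let Q = q^2 where q is a power of p, m = 2, J = ∅, N_1 = q^2 and N_2 = q (so n_J = q^3 and the evaluation points are all of F_{q^2} × { x ∈ F_{q^2} : x^q = x }). Let t be a positive integer with t < min { (q^2 + q + 1)/2 , 4q + 1 }. Then F(∅,t) ⊆ F(∅,t)^{⊥_h} (Hermitian duality), dim_{F_{q^2}} F(∅,t) = card(N(∅,t)), and every nonzero codeword of F(∅,t)^{⊥_h} has Hamming weight at least t. -/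
theorem false_of_complementary_mul_lt {q t A C B A' C' B' : ℕ} (hA : 1 ≤ A) (hA' : 1 ≤ A')
    (hB : 1 ≤ B) (hB' : 1 ≤ B') (hBB : B + B' = q + 1) (hAC : A + C' = q) (hCA : A' + C = q)
    (h1 : (A + C * q) * B < t) (h2 : (A' + C' * q) * B' < t)
    (ht1 : 2 * t < q ^ 2 + q + 1) (ht2 : t < 4 * q + 1) : False := by
  have key : ∀ {A C B A' C' B' : ℕ}, 1 ≤ B → 1 ≤ B' → B + B' = q + 1 → A + C' = q → A' + C = q →
      C = 0 → (A + C * q) * B < t → (A' + C' * q) * B' < t → False := by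
    rintro A C B A' C' B' hB hB' hBB rfl hCA rfl h1 h2
    simp only [zero_mul, add_zero] at h1 hCA
    subst hCA
    have h3 : (1 + C') * B' < 4 := by
      by_contra! h
      have := Nat.mul_le_mul_left (A + C') h
      linarith
    have hmul : A * B + A * B' = A * (A + C' + 1) := by rw [← mul_add, hBB]
    have hC' : C' < 3 := by
      by_contra! h
      have := Nat.mul_le_mul (Nat.add_le_add_left h 1) hB'
      omega
    have hB'3 : B' < 4 := by
      by_contra! h
      have := Nat.mul_le_mul (Nat.le_add_right 1 C') h
      omega
    interval_cases C' <;> interval_cases B' <;> first | omega | (ring_nf at *; omega)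
  rcases Nat.eq_zero_or_pos C with hC | hC
  · exact key hB hB' hBB hAC hCA hC h1 h2
  rcases Nat.eq_zero_or_pos C' with hC' | hC'
  · exact key hB' hB (by omega) hCA hAC hC' h2 h1
  have e1 : (q + 1) * B < t := lt_of_le_of_lt
    (Nat.mul_le_mul_right B (by nlinarith [Nat.mul_le_mul_right q hC])) h1
  have e2 : (q + 1) * B' < t := lt_of_le_of_lt
    (Nat.mul_le_mul_right B' (by nlinarith [Nat.mul_le_mul_right q hC'])) h2
  nlinarith

theorem digits_of_dvd {q a₀ a₁ a₀' a₁' : ℕ} (hq : 2 ≤ q) (h₀ : a₀ < q) (h₁ : a₁ < q)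
    (h₀' : a₀' < q) (h₁' : a₁' < q)
    (hdvd : q ^ 2 - 1 ∣ (a₀ + q * a₁) + q * (a₀' + q * a₁'))
    (hpos : (a₀ + q * a₁) + q * (a₀' + q * a₁') ≠ 0) :
    (a₀ + a₁' = q - 1 ∧ a₁ + a₀' = q - 1) ∨ (a₀ + 1 = q ∧ a₁ + 1 = q) := by
  have hq2 : 4 ≤ q ^ 2 := by nlinarith
  have hdvd' : q ^ 2 - 1 ∣ (a₀ + a₁') + q * (a₁ + a₀') := by
    have e : (a₀ + q * a₁) + q * (a₀' + q * a₁') =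
        (a₀ + a₁') + q * (a₁ + a₀') + (q ^ 2 - 1) * a₁' := by
      zify [show 1 ≤ q ^ 2 by omega]; ring
    rw [e] at hdvd
    exact (Nat.dvd_add_left (dvd_mul_right _ _)).mp hdvd
  obtain ⟨k, hk⟩ := hdvd'
  have hk0 : k ≠ 0 := by
    rintro rfl
    apply hpos
    have : a₀ + a₁' = 0 := by omega
    have h : q * (a₁ + a₀') = 0 := by omega
    have : a₁ + a₀' = 0 := by
      rcases Nat.mul_eq_zero.mp h with h | h <;> omega
    obtain ⟨rfl, rfl⟩ : a₀ = 0 ∧ a₁' = 0 := by omega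
    obtain ⟨rfl, rfl⟩ : a₁ = 0 ∧ a₀' = 0 := by omega
    simp
  obtain ⟨s, hs⟩ : ∃ s, q ^ 2 = s + 1 := ⟨q ^ 2 - 1, by omega⟩
  rw [hs, Nat.add_sub_cancel] at hk
  have hk2 : k ≤ 2 := by
    by_contra! h
    nlinarith
  obtain ⟨r, rfl⟩ : ∃ r, q = r + 1 := ⟨q - 1, by omega⟩
  have hv : a₁ + a₀' ≤ 2 * r := by omega
  have hu : a₀ + a₁' ≤ 2 * r := by omega
  interval_cases k
  · exact absurd rfl hk0
  · left
    have hv2 : a₁ + a₀' = r := by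
      apply le_antisymm <;> by_contra! h <;> nlinarith
    refine ⟨?_, by omega⟩
    rw [hv2] at hk
    have : a₀ + a₁' = r := by nlinarith
    omega
  · right
    have hv2 : a₁ + a₀' = 2 * r := by
      apply le_antisymm hv; by_contra! h; nlinarith
    rw [hv2] at hk
    have : a₀ + a₁' = 2 * r := by nlinarith
    omega

theorem not_dvd_of_mul_lt {q t a b a' b' : ℕ} (hq : 2 ≤ q) (hb : b < q) (hb' : b' < q)
    (h : (a + 1) * (b + 1) < t) (h' : (a' + 1) * (b' + 1) < t)
    (ht1 : 2 * t < q ^ 2 + q + 1) (ht2 : t < 4 * q + 1) :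
    (a + q * a' = 0 ∨ ¬ q ^ 2 - 1 ∣ a + q * a') ∨ (b + b' = 0 ∨ ¬ q - 1 ∣ b + b') := by
  by_contra! hcon
  obtain ⟨⟨ha0, hda⟩, hb0, hdb⟩ := hcon
  have haq : a + 1 < q ^ 2 := by nlinarith
  have haq' : a' + 1 < q ^ 2 := by nlinarith
  have hq0 : 0 < q := by omega
  have hm := Nat.mod_add_div a q
  have hm' := Nat.mod_add_div a' q
  have hm0 := Nat.mod_lt a hq0
  have hm0' := Nat.mod_lt a' hq0
  have hm1 : a / q < q := Nat.div_lt_of_lt_mul (by nlinarith)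
  have hm1' : a' / q < q := Nat.div_lt_of_lt_mul (by nlinarith)
  generalize a % q = a₀ at *
  generalize a / q = a₁ at *
  generalize a' % q = a₀' at *
  generalize a' / q = a₁' at *
  subst hm hm'
  rcases digits_of_dvd hq hm0 hm1 hm0' hm1' hda ha0 with ⟨h1, h2⟩ | ⟨h1, h2⟩
  · obtain ⟨k, hk⟩ := hdb
    obtain ⟨r, rfl⟩ : ∃ r, q = r + 1 := ⟨q - 1, by omega⟩
    rw [Nat.add_sub_cancel] at *
    have hk0 : k ≠ 0 := by rintro rfl; omega
    have hk2 : k ≤ 2 := by by_contra! h; nlinarith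
    interval_cases k
    · exact hk0 rfl
    · refine false_of_complementary_mul_lt (q := r + 1) (A := a₀ + 1) (C := a₁) (B := b + 1) (A' := a₀' + 1)
        (C' := a₁') (B' := b' + 1) (t := t) ?_ ?_ ?_ ?_ ?_ ?_ ?_ ?_ ?_ ht1 ht2 <;> first
        | omega
        | (ring_nf at *; assumption)
    · obtain ⟨rfl, rfl⟩ : r = b ∧ b' = b := by omega
      have small : ∀ {x : ℕ}, (x + 1) * (b' + 1) < t → 2 * (x + 1) < b' + 2 := fun {x} hx => by
        by_contra! hcon
        have := Nat.mul_le_mul_right (b' + 1) hcon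
        linarith
      have e1 := small h
      have e2 := small h'
      have : a₁ = 0 := by by_contra! hne; have := Nat.pos_of_ne_zero hne; nlinarith
      have : a₁' = 0 := by by_contra! hne; have := Nat.pos_of_ne_zero hne; nlinarith
      subst_vars
      omega
  · obtain ⟨rfl⟩ : a₁ = a₀ := by omega
    subst h1
    nlinarith

section FixedPowers

variable {F : Type} [Field F] [Fintype F]

theorem exists_isPrimitiveRoot_of_dvd_card_sub_one {d : ℕ} (hd : d ∣ Fintype.card F - 1) :
    ∃ ζ : F, IsPrimitiveRoot ζ d := by
  classical
  obtain ⟨k, hk⟩ := hd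
  obtain ⟨g, hg⟩ := IsCyclic.exists_ofOrder_eq_natCard (α := Fˣ)
  rw [Nat.card_eq_fintype_card, Fintype.card_units] at hg
  have hprim : IsPrimitiveRoot (g : F) (Fintype.card F - 1) := by
    rw [IsPrimitiveRoot.coe_units_iff, ← hg]
    exact IsPrimitiveRoot.orderOf g
  exact ⟨_, hprim.pow (by have := Fintype.one_lt_card (α := F); omega) (hk.trans (mul_comm _ _))⟩

variable [DecidableEq F]

theorem card_filter_pow_eq_self {n : ℕ} (hn : 1 < n) (hd : n - 1 ∣ Fintype.card F - 1) :
    (Finset.univ.filter fun x : F => x ^ n = x).card = n := by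
  obtain ⟨ζ, hζ⟩ := exists_isPrimitiveRoot_of_dvd_card_sub_one (F := F) hd
  have hset : (Finset.univ.filter fun x : F => x ^ n = x) =
      insert 0 (Polynomial.nthRootsFinset (n - 1) (1 : F)) := by
    ext x
    obtain ⟨d, rfl⟩ : ∃ d, n = d + 1 := ⟨n - 1, by omega⟩
    rw [Finset.mem_filter, Finset.mem_insert,
      Polynomial.mem_nthRootsFinset (by omega : 0 < d + 1 - 1)]
    by_cases hx : x = 0 <;> simp [hx, pow_succ]
  rw [hset, Finset.card_insert_of_notMem, hζ.card_nthRootsFinset]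
  · omega
  · rw [Polynomial.mem_nthRootsFinset (by omega)]
    simp [show n - 1 ≠ 0 by omega]

theorem sum_filter_pow_eq_self_pow {n s : ℕ} (hn : 1 < n) (hd : n - 1 ∣ Fintype.card F - 1)
    (hn0 : (n : F) = 0) (hs : s = 0 ∨ ¬ n - 1 ∣ s) :
    ∑ x ∈ Finset.univ.filter (fun x : F => x ^ n = x), x ^ s = 0 := by
  rcases hs with rfl | hs
  · simp [card_filter_pow_eq_self hn hd, hn0]
  obtain ⟨ζ, hζ⟩ := exists_isPrimitiveRoot_of_dvd_card_sub_one (F := F) hd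
  have hζ0 : ζ ≠ 0 := hζ.ne_zero (by omega)
  have hζn : ζ ^ n = ζ := by
    rw [show n = n - 1 + 1 by omega, pow_succ, hζ.pow_eq_one, one_mul]
  have hmul : ζ ^ s * ∑ x ∈ Finset.univ.filter (fun x : F => x ^ n = x), x ^ s =
      ∑ x ∈ Finset.univ.filter (fun x : F => x ^ n = x), x ^ s := by
    rw [Finset.mul_sum]
    refine Finset.sum_equiv (Equiv.mulLeft₀ ζ hζ0) (fun x => ?_) (fun x _ => ?_)
    · simp [mul_pow, hζn, hζ0]
    · simp [mul_pow]
  have hne : ζ ^ s ≠ 1 := fun h => hs ((hζ.pow_eq_one_iff_dvd s).mp h)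
  by_contra h
  exact hne (mul_right_cancel₀ h (hmul.trans (one_mul _).symm))

end FixedPowers

section Footprint

variable {F : Type*} [Field F]

theorem eq_zero_of_sum_mul_pow_eq_zero {f : F → F} {T : Finset F}
    (h : ∀ a < T.card, ∑ x ∈ T, f x * x ^ a = 0) : ∀ x ∈ T, f x = 0 := by
  classical
  intro x hx
  set P : Polynomial F := ∏ y ∈ T.erase x, (Polynomial.X - Polynomial.C y) with hP
  have hdeg : P.natDegree < T.card := by
    rw [hP, Polynomial.natDegree_finsetProd_X_sub_C_eq_card, Finset.card_erase_of_mem hx]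
    have := Finset.card_pos.mpr ⟨x, hx⟩
    omega
  have hsum : ∑ y ∈ T, f y * P.eval y = 0 := by
    simp_rw [Polynomial.eval_eq_sum_range' hdeg, Finset.mul_sum]
    rw [Finset.sum_comm]
    refine Finset.sum_eq_zero fun a ha => ?_
    have := h a (Finset.mem_range.mp ha)
    simp_rw [mul_left_comm (f _), ← Finset.mul_sum, this, mul_zero]
  rw [Finset.sum_eq_single_of_mem x hx] at hsum
  · refine (mul_eq_zero.mp hsum).resolve_right ?_
    rw [hP, Polynomial.eval_prod]
    refine Finset.prod_ne_zero_iff.mpr fun y hy => ?_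
    simpa [sub_eq_zero] using (Finset.ne_of_mem_erase hy).symm
  · intro y hy hyx
    rw [hP, Polynomial.eval_prod, Finset.prod_eq_zero (Finset.mem_erase.mpr ⟨hyx, hy⟩), mul_zero]
    simp

/-- A function on a grid `A × B` that is orthogonal to every monomial `x ^ a * y ^ b` whose
footprint `(a + 1) * (b + 1)` is at most the size of its support vanishes. -/
theorem eq_zero_of_sum_mul_pow_mul_pow_eq_zero [DecidableEq F] (A B : Finset F) (Z : F → F → F)
    (h : ∀ a b, a < A.card → b < B.card →
      (a + 1) * (b + 1) ≤ ((A ×ˢ B).filter fun z => Z z.1 z.2 ≠ 0).card →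
      ∑ x ∈ A, ∑ y ∈ B, Z x y * (x ^ a * y ^ b) = 0) :
    ∀ x ∈ A, ∀ y ∈ B, Z x y = 0 := by
  set S := (A ×ˢ B).filter fun z => Z z.1 z.2 ≠ 0 with hS
  set K := S.image Prod.fst with hK
  set col : F → Finset F := fun x => B.filter fun y => Z x y ≠ 0 with hcol
  have hcolsum : ∀ x b, ∑ y ∈ B, Z x y * y ^ b = ∑ y ∈ col x, Z x y * y ^ b := fun x b =>
    (Finset.sum_subset (Finset.filter_subset _ _) fun y hy hn => by
      have : Z x y = 0 := by simpa [hcol, hy] using hn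
      rw [this, zero_mul]).symm
  have hKA : K ⊆ A := by
    intro x hx
    simp only [hK, hS, Finset.mem_image, Finset.mem_filter, Finset.mem_product] at hx
    obtain ⟨z, ⟨⟨hz, -⟩, -⟩, rfl⟩ := hx
    exact hz
  have hZ0 : ∀ x ∈ A, x ∉ K → ∀ y ∈ B, Z x y = 0 := by
    intro x hx hxK y hy
    by_contra hne
    exact hxK (Finset.mem_image.mpr ⟨(x, y), by simp [hS, hx, hy, hne], rfl⟩)
  have hcard : S.card = ∑ x ∈ K, (col x).card := by
    rw [Finset.card_eq_sum_card_image Prod.fst S]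
    refine Finset.sum_congr rfl fun x hx => ?_
    refine Finset.card_bij' (fun z _ => z.2) (fun y _ => (x, y)) ?_ ?_ ?_ ?_
    · rintro ⟨u, v⟩ hz
      simp only [hS, Finset.mem_filter, Finset.mem_product] at hz
      obtain ⟨⟨⟨-, hv⟩, hne⟩, rfl⟩ := hz
      simp [hcol, hv, hne]
    · intro y hy
      simp only [hcol, Finset.mem_filter] at hy
      simp [hS, hKA hx, hy.1, hy.2]
    · rintro ⟨u, v⟩ hz
      simp only [Finset.mem_filter] at hz
      rw [← hz.2]
    · intro y hy
      rfl
  have hcolK : ∀ x ∈ K, (col x).Nonempty := by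
    intro x hx
    simp only [hK, hS, Finset.mem_image, Finset.mem_filter, Finset.mem_product] at hx
    obtain ⟨z, ⟨⟨-, hz⟩, hne⟩, rfl⟩ := hx
    exact ⟨z.2, by simp [hcol, hz, hne]⟩
  have hlarge : ∀ n, (∀ b < n, ∀ x ∈ K, ∑ y ∈ B, Z x y * y ^ b = 0) →
      ∀ x ∈ K, n < (col x).card := by
    intro n hn x hx
    by_contra! hle
    obtain ⟨y, hy⟩ := hcolK x hx
    have := eq_zero_of_sum_mul_pow_eq_zero (f := Z x) (T := col x)
      (fun b hb => (hcolsum x b).symm.trans (hn b (hb.trans_le hle) x hx)) y hy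
    exact (Finset.mem_filter.mp hy).2 this
  have hvanish : ∀ n, ∀ x ∈ K, ∑ y ∈ B, Z x y * y ^ n = 0 := by
    intro n
    induction n using Nat.strong_induction_on with
    | _ n ih =>
      have hgt := hlarge n ih
      refine eq_zero_of_sum_mul_pow_eq_zero fun a ha => ?_
      have hn : n < B.card := by
        obtain ⟨x, hx⟩ := Finset.card_pos.mp (by omega : 0 < K.card)
        exact (hgt x hx).trans_le (Finset.card_le_card (Finset.filter_subset _ _))
      have hle : (a + 1) * (n + 1) ≤ S.card := by
        calc (a + 1) * (n + 1) ≤ K.card * (n + 1) := Nat.mul_le_mul_right _ ha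
          _ ≤ S.card := by
            rw [hcard, ← smul_eq_mul]
            exact Finset.card_nsmul_le_sum _ _ _ hgt
      have hsum := h a n (ha.trans_le (Finset.card_le_card hKA)) hn hle
      rw [← hsum, ← Finset.sum_subset hKA]
      · refine Finset.sum_congr rfl fun x _ => ?_
        rw [Finset.sum_mul]
        exact Finset.sum_congr rfl fun y _ => by ring
      · intro x hx hxK
        exact Finset.sum_eq_zero fun y hy => by rw [hZ0 x hx hxK y hy, zero_mul]
  intro x hx y hy
  by_cases hxK : x ∈ K
  · have h1 := hlarge B.card (fun b _ => hvanish b) x hxK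
    exact absurd (Finset.card_le_card (Finset.filter_subset (fun y => Z x y ≠ 0) B)) h1.not_ge
  · exact hZ0 x hx hxK y hy

end Footprint

/-- Self-orthogonality of a span for the form `∑ i, x i * y i ^ p ^ e` can be checked on
generators. -/
theorem sum_mul_pow_eq_zero_of_mem_span {F ι : Type*} [Field F] [Fintype ι] (p e : ℕ)
    [Fact p.Prime]
    [CharP F p] {s : Set (ι → F)} (h : ∀ x ∈ s, ∀ y ∈ s, ∑ i, x i * y i ^ p ^ e = 0) {x y : ι → F}
    (hx : x ∈ Submodule.span F s) (hy : y ∈ Submodule.span F s) :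
    ∑ i, x i * y i ^ p ^ e = 0 := by
  have hpe : p ^ e ≠ 0 := pow_ne_zero _ (Fact.out : p.Prime).ne_zero
  induction hx using Submodule.span_induction with
  | zero => simp
  | add u v _ _ hu hv => simp [add_mul, Finset.sum_add_distrib, hu, hv]
  | smul c u _ hu => simp [mul_assoc, ← Finset.mul_sum, hu]
  | mem x hx =>
    induction hy using Submodule.span_induction with
    | mem y hy => exact h x hx y hy
    | zero => simp [zero_pow hpe]
    | add u v _ _ hu hv => simp [add_pow_char_pow, mul_add, Finset.sum_add_distrib, hu, hv]
    | smul c u _ hu => simp [mul_pow, mul_left_comm (x _), ← Finset.mul_sum, hu]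

section Evaluation

variable {F : Type} [Field F] [Fintype F] [DecidableEq F]

theorem mem_ZJ_empty {m : ℕ} {N : Fin m → ℕ} {x : Fin m → F} :
    x ∈ ZJ F N (∅ : Finset (Fin m)) ↔ ∀ j, x j ^ N j = x j := by
  simp [ZJ]

theorem mem_NSet_empty_two {N : Fin 2 → ℕ} {t : ℕ} {b : Fin 2 → ℕ} :
    b ∈ NSet N (∅ : Finset (Fin 2)) t ↔
      (b 0 ≤ N 0 - 1 ∧ b 1 ≤ N 1 - 1) ∧ (b 0 + 1) * (b 1 + 1) < t := by
  simp [NSet, eps, Fin.forall_fin_two, Fin.prod_univ_two]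

theorem sum_ZJ_empty_two (N : Fin 2 → ℕ) (g : F → F → F) :
    ∑ i : ↥(ZJ F N (∅ : Finset (Fin 2))), g (i.1 0) (i.1 1) =
      ∑ x ∈ Finset.univ.filter (fun x : F => x ^ N 0 = x),
        ∑ y ∈ Finset.univ.filter (fun y : F => y ^ N 1 = y), g x y := by
  rw [Finset.sum_coe_sort (ZJ F N ∅) fun i => g (i 0) (i 1), ← Finset.sum_product']
  refine Finset.sum_equiv (finTwoArrowEquiv F) (fun i => ?_) (fun i _ => rfl)
  simp [mem_ZJ_empty, Fin.forall_fin_two]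

theorem linearIndependent_evm_s17 {m : ℕ} {N : Fin m → ℕ}
    (hN : ∀ j, (Finset.univ.filter fun x : F => x ^ N j = x).card = N j) (s : Set (Fin m → ℕ))
    (hs : ∀ b ∈ s, ∀ j, b j < N j) :
    LinearIndependent F fun b : s => evm F N (∅ : Finset (Fin m)) b := by
  classical
  have hfin : Finite s := by
    refine Set.Finite.to_subtype ((Set.finite_Iic N).subset fun b hb j => (hs b hb j).le)
  have := Fintype.ofFinite s
  rw [Fintype.linearIndependent_iff]
  intro c hc b
  set P : MvPolynomial (Fin m) F :=
    ∑ b : s, MvPolynomial.monomial (Finsupp.equivFunOnFinite.symm b.1) (c b) with hP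
  have hP0 : P = 0 := by
    refine MvPolynomial.eq_zero_of_eval_zero_at_prod_finset P
      (fun j => Finset.univ.filter fun x : F => x ^ N j = x) (fun j => ?_) (fun x hx => ?_)
    · rw [hN, MvPolynomial.degreeOf_lt_iff ((Nat.zero_le _).trans_lt (hs b b.2 j))]
      intro d hd
      obtain ⟨b', -, hb'⟩ := Finset.mem_biUnion.mp (MvPolynomial.support_sum hd)
      have := Finset.mem_singleton.mp (MvPolynomial.support_monomial_subset hb')
      rw [this]
      exact hs b' b'.2 j
    · have hxZ : x ∈ ZJ F N (∅ : Finset (Fin m)) :=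
        mem_ZJ_empty.mpr fun j => (Finset.mem_filter.mp (hx j)).2
      have := congrFun hc ⟨x, hxZ⟩
      simpa [hP, MvPolynomial.eval_monomial, Finsupp.prod_fintype, evm, Finset.sum_apply] using this
  have hcoeff := congrArg (MvPolynomial.coeff (Finsupp.equivFunOnFinite.symm b.1)) hP0
  rw [hP, MvPolynomial.coeff_sum, Finset.sum_eq_single b] at hcoeff
  · simpa using hcoeff
  · intro b' _ hne
    rw [MvPolynomial.coeff_monomial, if_neg]
    exact fun h => hne (Subtype.ext (Finsupp.equivFunOnFinite.symm.injective h))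
  · simp

theorem finrank_Fcode_empty {m : ℕ} {N : Fin m → ℕ}
    (hN : ∀ j, (Finset.univ.filter fun x : F => x ^ N j = x).card = N j) (hpos : ∀ j, 0 < N j)
    (t : ℕ) :
    Module.finrank F (Fcode F N (∅ : Finset (Fin m)) t) =
      Nat.card (NSet N (∅ : Finset (Fin m)) t) := by
  have hlt : ∀ b ∈ NSet N (∅ : Finset (Fin m)) t, ∀ j, b j < N j := fun b hb j => by
    have := (hb.1 j).2
    have := hpos j
    omega
  have hfin : Finite (NSet N (∅ : Finset (Fin m)) t) :=
    ((Set.finite_Iic N).subset fun b hb j => (hlt b hb j).le).to_subtype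
  have := Fintype.ofFinite (NSet N (∅ : Finset (Fin m)) t)
  have hset : { v | ∃ b ∈ NSet N (∅ : Finset (Fin m)) t, v = evm F N ∅ b } =
      Set.range fun b : NSet N (∅ : Finset (Fin m)) t => evm F N ∅ b.1 := by
    ext v
    simp [eq_comm]
  rw [Fcode, hset, finrank_span_eq_card (linearIndependent_evm_s17 hN _ hlt),
    Nat.card_eq_fintype_card]

theorem le_card_support_of_orthogonal_evm {N : Fin 2 → ℕ}
    (hN : ∀ j, (Finset.univ.filter fun x : F => x ^ N j = x).card = N j) {t : ℕ}
    (z : ↥(ZJ F N (∅ : Finset (Fin 2))) → F)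
    (hz : ∀ b ∈ NSet N (∅ : Finset (Fin 2)) t, ∑ i, evm F N ∅ b i * z i = 0) (hz0 : z ≠ 0) :
    t ≤ (Finset.univ.filter fun i => z i ≠ 0).card := by
  by_contra! hlt
  apply hz0
  set A := Finset.univ.filter fun x : F => x ^ N 0 = x with hA
  set B := Finset.univ.filter fun x : F => x ^ N 1 = x with hB
  let Z : F → F → F := fun x y =>
    if h : ![x, y] ∈ ZJ F N (∅ : Finset (Fin 2)) then z ⟨![x, y], h⟩ else 0
  have hZ : ∀ i, Z (i.1 0) (i.1 1) = z i := by
    intro i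
    have he : ![i.1 0, i.1 1] = i.1 := by
      ext j
      fin_cases j <;> rfl
    have hmem : ![i.1 0, i.1 1] ∈ ZJ F N (∅ : Finset (Fin 2)) := he.symm ▸ i.2
    simp only [Z, dif_pos hmem]
    exact congrArg z (Subtype.ext he)
  have hcard : ((A ×ˢ B).filter fun u => Z u.1 u.2 ≠ 0).card =
      (Finset.univ.filter fun i => z i ≠ 0).card := by
    symm
    refine Finset.card_bij (fun i _ => (i.1 0, i.1 1)) ?_ ?_ ?_
    · intro i hi
      have := mem_ZJ_empty.mp i.2
      simp only [Finset.mem_filter, Finset.mem_univ, true_and] at hi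
      simp [hA, hB, hZ, hi, this]
    · intro i _ j _ hij
      obtain ⟨h0, h1⟩ := Prod.mk.inj hij
      ext k
      fin_cases k
      exacts [h0, h1]
    · rintro ⟨x, y⟩ hxy
      simp only [hA, hB, Finset.mem_filter, Finset.mem_product, Finset.mem_univ, true_and] at hxy
      refine ⟨⟨![x, y], mem_ZJ_empty.mpr (Fin.forall_fin_two.mpr hxy.1)⟩, ?_, rfl⟩
      rw [Finset.mem_filter, ← hZ]
      exact ⟨Finset.mem_univ _, hxy.2⟩
  have hvan := eq_zero_of_sum_mul_pow_mul_pow_eq_zero A B Z fun a b ha hb hab => by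
    rw [hA, hN] at ha
    rw [hB, hN] at hb
    rw [← sum_ZJ_empty_two N fun x y => Z x y * (x ^ a * y ^ b),
      ← hz ![a, b] (mem_NSet_empty_two.mpr ⟨⟨?_, ?_⟩, ?_⟩)]
    · refine Finset.sum_congr rfl fun i _ => ?_
      rw [hZ, mul_comm]
      simp [evm, Fin.prod_univ_two]
    · exact Nat.le_sub_one_of_lt ha
    · exact Nat.le_sub_one_of_lt hb
    · exact (hab.trans_eq hcard).trans_lt hlt
  funext i
  have := mem_ZJ_empty.mp i.2
  rw [← hZ]
  exact hvan _ (by simp [hA, this]) _ (by simp [hB, this])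

end Evaluation

/-- Corollary 3 of the paper. Over `F_{q^2}`, with `m = 2`,
`J = ∅`, `N_1 = q^2` and `N_2 = q`, for every positive
`t < min { (q^2 + q + 1)/2, 4q + 1 }`, the code `F(∅,t)` is Hermitian
self-orthogonal, has dimension `card N(∅,t)`, and its Hermitian dual has minimum
distance at least `t`. -/
theorem Fcode_q2_q_hermitian_self_orthogonal
    (p e : ℕ) (hp : p.Prime) (he : 0 < e)
    (F : Type) [Field F] [Fintype F] [DecidableEq F]
    (hF : Fintype.card F = (p ^ e) ^ 2)
    (N : Fin 2 → ℕ) (hN0 : N 0 = (p ^ e) ^ 2) (hN1 : N 1 = p ^ e)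
    (t : ℕ) (ht : 1 ≤ t)
    (ht1 : 2 * t < (p ^ e) ^ 2 + p ^ e + 1) (ht2 : t < 4 * p ^ e + 1) :
    (∀ x ∈ Fcode F N (∅ : Finset (Fin 2)) t, ∀ y ∈ Fcode F N (∅ : Finset (Fin 2)) t,
      ∑ i, x i * y i ^ (p ^ e) = 0) ∧
    Module.finrank F (Fcode F N (∅ : Finset (Fin 2)) t) =
      Nat.card (NSet N (∅ : Finset (Fin 2)) t) ∧
    (∀ y : ↥(ZJ F N (∅ : Finset (Fin 2))) → F,
      (∀ x ∈ Fcode F N (∅ : Finset (Fin 2)) t, ∑ i, x i * y i ^ (p ^ e) = 0) →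
      y ≠ 0 →
      t ≤ (Finset.univ.filter (fun i => y i ≠ 0)).card) := by
  have hpf : Fact p.Prime := ⟨hp⟩
  have hchar : CharP F p := charP_of_card_eq_prime_pow (f := e * 2) (by rw [hF, pow_mul])
  set q := p ^ e with hq
  have hq2 : 2 ≤ q := hp.two_le.trans (Nat.le_self_pow he.ne' p)
  have hcast : (q : F) = 0 := by
    rw [hq, Nat.cast_pow, CharP.cast_eq_zero, zero_pow he.ne']
  have hN1lt : ∀ j, 1 < N j := Fin.forall_fin_two.mpr ⟨by rw [hN0]; nlinarith, by omega⟩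
  have hdvd : ∀ j, N j - 1 ∣ Fintype.card F - 1 := by
    refine Fin.forall_fin_two.mpr ⟨by rw [hN0, hF], ?_⟩
    rw [hN1, hF]
    simpa using Nat.sub_dvd_pow_sub_pow q 1 2
  have hNF : ∀ j, (N j : F) = 0 :=
    Fin.forall_fin_two.mpr ⟨by rw [hN0]; simp [hcast], by rw [hN1, hcast]⟩
  have hNcard := fun j => card_filter_pow_eq_self (F := F) (hN1lt j) (hdvd j)
  refine ⟨fun x hx y hy => sum_mul_pow_eq_zero_of_mem_span p e ?_ hx hy,
    finrank_Fcode_empty hNcard (fun j => (Nat.zero_lt_one.trans (hN1lt j))) t,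
    fun y hy hy0 => ?_⟩
  · rintro _ ⟨b, hb, rfl⟩ _ ⟨b', hb', rfl⟩
    rw [mem_NSet_empty_two] at hb hb'
    have hexp := not_dvd_of_mul_lt hq2 (by omega : b 1 < q) (by omega : b' 1 < q) hb.2 hb'.2
      ht1 ht2
    calc ∑ i, evm F N ∅ b i * evm F N ∅ b' i ^ q
        = ∑ i : ↥(ZJ F N (∅ : Finset (Fin 2))),
            i.1 0 ^ (b 0 + q * b' 0) * i.1 1 ^ (b 1 + b' 1) := by
          refine Finset.sum_congr rfl fun i _ => ?_
          have h1 : i.1 1 ^ q = i.1 1 := hN1 ▸ mem_ZJ_empty.mp i.2 1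
          simp only [evm, Fin.prod_univ_two, mul_pow, ← pow_mul, mul_comm _ q]
          rw [pow_mul (i.1 1) q, h1]
          ring
      _ = (∑ x ∈ Finset.univ.filter (fun x : F => x ^ N 0 = x), x ^ (b 0 + q * b' 0)) *
            ∑ y ∈ Finset.univ.filter (fun y : F => y ^ N 1 = y), y ^ (b 1 + b' 1) := by
          rw [sum_ZJ_empty_two N fun x y => x ^ (b 0 + q * b' 0) * y ^ (b 1 + b' 1),
            Finset.sum_mul_sum]
      _ = 0 := by
          rcases hexp with h | h
          · rw [sum_filter_pow_eq_self_pow (hN1lt 0) (hdvd 0) (hNF 0) (by rwa [hN0]), zero_mul]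
          · rw [sum_filter_pow_eq_self_pow (hN1lt 1) (hdvd 1) (hNF 1) (by rwa [hN1]), mul_zero]
  · have hq0 : q ≠ 0 := by omega
    have := le_card_support_of_orthogonal_evm hNcard (t := t) (fun i => y i ^ q)
      (fun b hb => hy _ (Submodule.subset_span ⟨b, hb, rfl⟩))
      (fun h => hy0 (funext fun i => pow_eq_zero_iff hq0 |>.mp (congrFun h i)))
    simpa only [ne_eq, pow_eq_zero_iff hq0] using this
end
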